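/- Let G be a loopless graph and let q ∈ K, with Hecke parameters q_e = q for all edges e. Then the filtration of Ψ_{G,q} induced by the generators X_i coincides with the filtration induced from Φ_{G,q}: for every k ∈ ℕ, the K-linear span of all products X_1^{α_1}⋯X_n^{α_n} with α_1 + … + α_n ≤ k equals the intersection of Ψ_{G,q} with the image in Φ_{G,q} of the space of polynomials of total degree ≤ k in the variables u_e. -/

import Mathlib

open MvPolynomial

set_option synthInstance.maxHeartbeats 1000000
set_option maxHeartbeats 1000000

noncomputable section

/-- The ideal of relations `u_e ^ 2 = q_e * u_e`. -/
def relIdeal (K : Type*) [Field K] (E : Type*) (q : E → K) :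
    Ideal (MvPolynomial E K) :=
  Ideal.span (Set.range fun e : E => (X e) ^ 2 - C (q e) * X e)

/-- The algebra `Φ_{G,Q}`. -/
abbrev PhiAlg (K : Type*) [Field K] (E : Type*) (q : E → K) : Type _ :=
  MvPolynomial E K ⧸ relIdeal K E q

/-- The generator `X_i` of the `Q`-deformation. -/
def XX (K : Type*) [Field K] {n : ℕ} {E : Type*} [Fintype E]
    (a b : E → Fin n) (q : E → K) (i : Fin n) : PhiAlg K E q :=
  Ideal.Quotient.mk _
    ((∑ e ∈ Finset.univ.filter fun e => a e = i, X e) -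
      ∑ e ∈ Finset.univ.filter fun e => b e = i, X e)

/-- The `Q`-deformation `Ψ_{G,Q}` of the Postnikov–Shapiro algebra. -/
def PsiAlg (K : Type*) [Field K] {n : ℕ} {E : Type*} [Fintype E]
    (a b : E → Fin n) (q : E → K) : Subalgebra K (PhiAlg K E q) :=
  Algebra.adjoin K (Set.range (XX K a b q))

/-- The `k`-th piece of the filtration of `Ψ_{G,Q}` induced by the generators `X_i`. -/
def Fk (K : Type*) [Field K] {n : ℕ} {E : Type*} [Fintype E]
    (a b : E → Fin n) (q : E → K) (k : ℕ) : Submodule K (PhiAlg K E q) :=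
  Submodule.span K
    {y | ∃ α : Fin n → ℕ, (∑ i, α i) ≤ k ∧ y = ∏ i, (XX K a b q i) ^ (α i)}


/-- Functional realizing a "closed" family of top coefficients. -/
lemma exists_functional {K : Type*} [Field K] {V : Type*} [DecidableEq V] {E : Type*}
    [DecidableEq E] (A : Finset E) : ∀ (a b : E → V) (y : Finset E → K),
    (∀ S ⊆ A, ∃ φ : V → K, ∀ e ∈ A, e ∉ S → y (insert e S) = φ (a e) - φ (b e)) →
    ∃ l : MvPolynomial V K →ₗ[K] K, ∀ S ⊆ A,
      y S = l (∏ e ∈ S, (X (a e) - X (b e))) := by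
  induction A using Finset.induction_on with
  | empty =>
    intro a b y _
    refine ⟨y ∅ • MvPolynomial.lcoeff K 0, ?_⟩
    intro S hS
    rw [Finset.subset_empty.mp hS]
    simp
  | insert e₀ A he₀ ih =>
    intro a b y hy
    by_cases hloop : a e₀ = b e₀
    · obtain ⟨l, hl⟩ := ih a b y (fun S hS => by
        obtain ⟨φ, hφ⟩ := hy S (hS.trans (Finset.subset_insert _ _))
        exact ⟨φ, fun e he => hφ e (Finset.mem_insert_of_mem he)⟩)
      refine ⟨l, fun S hS => ?_⟩
      by_cases h : e₀ ∈ S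
      · have h1 : S.erase e₀ ⊆ A := by
          intro x hx
          have := hS (Finset.mem_of_mem_erase hx)
          exact (Finset.mem_insert.mp this).resolve_left (Finset.ne_of_mem_erase hx)
        obtain ⟨φ, hφ⟩ := hy (S.erase e₀) (h1.trans (Finset.subset_insert _ _))
        have h2 := hφ e₀ (Finset.mem_insert_self _ _) (Finset.notMem_erase _ _)
        rw [Finset.insert_erase h, hloop, sub_self] at h2
        rw [h2, Finset.prod_eq_zero h (by rw [hloop, sub_self]), map_zero]
      · exact hl S ((Finset.subset_insert_iff_of_notMem h).mp hS)
    · -- main case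
      set p : MvPolynomial V K := X (a e₀) - X (b e₀) with hp
      have hp0 : p ≠ 0 := by
        rw [hp, sub_ne_zero]
        exact fun h => hloop (X_injective h)
      obtain ⟨l', hl'⟩ := ih a b (fun S => y (insert e₀ S)) (fun S hS => by
        obtain ⟨φ, hφ⟩ := hy (insert e₀ S) (Finset.insert_subset_insert _ hS)
        refine ⟨φ, fun e he heS => ?_⟩
        have hne : e ≠ e₀ := fun h => he₀ (h ▸ he)
        have := hφ e (Finset.mem_insert_of_mem he) (by simp [hne, heS])
        rw [← this, Finset.insert_comm])
      obtain ⟨g, hg⟩ := LinearMap.exists_leftInverse_of_injective (LinearMap.mulLeft K p)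
        (by
          rw [LinearMap.ker_eq_bot]
          intro x z h
          exact mul_left_cancel₀ hp0 h)
      set l₁ := l' ∘ₗ g with hl₁
      have hl₁p : ∀ r, l₁ (p * r) = l' r := fun r => by
        have := LinearMap.congr_fun hg r
        simp only [LinearMap.comp_apply, LinearMap.mulLeft_apply, LinearMap.id_apply] at this
        simp [hl₁, this]
      -- the corrected family
      set y₂ : Finset E → K := fun S => y S - l₁ (∏ e ∈ S, (X (a e) - X (b e))) with hy₂
      have hy₂0 : ∀ S ⊆ A, y₂ (insert e₀ S) = 0 := by
        intro S hS
        have h : e₀ ∉ S := fun h => he₀ (hS h)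
        simp only [hy₂]
        rw [Finset.prod_insert h, ← hp, hl₁p, ← hl' S hS, sub_self]
      let π : V → V := fun v => if v = b e₀ then a e₀ else v
      obtain ⟨l₂, hl₂⟩ := ih (π ∘ a) (π ∘ b) y₂ (fun S hS => by
        obtain ⟨φ, hφ⟩ := hy S (hS.trans (Finset.subset_insert _ _))
        have key : ∀ e ∈ insert e₀ A, e ∉ S → y₂ (insert e S) =
            (φ (a e) - l₁ ((∏ e ∈ S, (X (a e) - X (b e))) * X (a e))) -
            (φ (b e) - l₁ ((∏ e ∈ S, (X (a e) - X (b e))) * X (b e))) := by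
          intro e he heS
          simp only [hy₂]
          rw [hφ e he heS, Finset.prod_insert heS, mul_comm, mul_sub, map_sub]
          ring
        have h0 := key e₀ (Finset.mem_insert_self _ _) (fun h => he₀ (hS h))
        rw [hy₂0 S hS] at h0
        refine ⟨fun v => φ v - l₁ ((∏ e ∈ S, (X (a e) - X (b e))) * X v), fun e he heS => ?_⟩
        rw [key e (Finset.mem_insert_of_mem he) heS]
        have hπ : ∀ v, φ (π v) - l₁ ((∏ e ∈ S, (X (a e) - X (b e))) * X (π v)) =
            φ v - l₁ ((∏ e ∈ S, (X (a e) - X (b e))) * X v) := by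
          intro v
          by_cases hv : v = b e₀
          · simp only [π, hv, if_true]
            exact (sub_eq_zero.mp h0.symm)
          · simp only [π, hv, if_false]
        simp only [Function.comp_apply, hπ])
      refine ⟨l₁ + l₂ ∘ₗ (rename π).toLinearMap, fun S hS => ?_⟩
      have hren : rename π (∏ e ∈ S, (X (a e) - X (b e)) : MvPolynomial V K) =
          ∏ e ∈ S, (X ((π ∘ a) e) - X ((π ∘ b) e)) := by
        simp [map_prod]
      simp only [LinearMap.add_apply, LinearMap.comp_apply, AlgHom.toLinearMap_apply, hren]
      suffices h : y₂ S = l₂ (∏ e ∈ S, (X ((π ∘ a) e) - X ((π ∘ b) e))) by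
        rw [← h]; simp [hy₂]
      by_cases h : e₀ ∈ S
      · have h1 : S.erase e₀ ⊆ A := by
          intro x hx
          have := hS (Finset.mem_of_mem_erase hx)
          exact (Finset.mem_insert.mp this).resolve_left (Finset.ne_of_mem_erase hx)
        rw [Finset.prod_eq_zero h, map_zero, ← Finset.insert_erase h, hy₂0 _ h1]
        simp only [Function.comp_apply, π]
        simp
      · exact hl₂ S ((Finset.subset_insert_iff_of_notMem h).mp hS)

/-- Evaluations at points suffice. -/
lemma mem_span_eval {K : Type*} [Field K] [Infinite K] {V : Type*} {E : Type*}
    [Fintype E] [DecidableEq E] (a b : E → V) (y : Finset E → K)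
    (l : MvPolynomial V K →ₗ[K] K) (hl : ∀ S, y S = l (∏ e ∈ S, (X (a e) - X (b e)))) :
    y ∈ Submodule.span K (Set.range fun (t : V → K) (S : Finset E) =>
      ∏ e ∈ S, (t (a e) - t (b e))) := by
  by_contra hcon
  obtain ⟨f, hf, hle⟩ := Submodule.exists_le_ker_of_notMem hcon
  apply hf
  have hrep : ∀ z : Finset E → K, f z = ∑ S, z S * f (Pi.single S 1) := by
    intro z
    conv_lhs => rw [← Finset.univ_sum_single z, map_sum]
    refine Finset.sum_congr rfl fun S _ => ?_
    rw [← smul_eq_mul, ← map_smul, ← Pi.single_smul]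
    simp
  have hz : (∑ S, f (Pi.single S 1) • ∏ e ∈ S, (X (a e) - X (b e)) : MvPolynomial V K) = 0 := by
    apply MvPolynomial.funext
    intro t
    have := hle (Submodule.subset_span (Set.mem_range_self t))
    rw [LinearMap.mem_ker, hrep] at this
    simp only [map_sum, smul_eval, map_prod, map_sub, eval_X, map_zero]
    rw [← this]
    exact Finset.sum_congr rfl fun S _ => mul_comm _ _
  have := congrArg l hz
  rw [map_sum, map_zero] at this
  rw [hrep, ← this]
  refine Finset.sum_congr rfl fun S _ => ?_
  rw [map_smul, smul_eq_mul, hl, mul_comm]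

/-- The simple graph underlying a set of edges. -/
def edgeGraph {V E : Type*} (a b : E → V) (A : Finset E) : SimpleGraph V :=
  SimpleGraph.fromRel fun x z => ∃ e ∈ A, a e = x ∧ b e = z

/-- Vector of an edge. -/
def edgeVec {V E : Type*} [DecidableEq V] (a b : E → V) (e : E) : V → ℤ :=
  Pi.single (a e) 1 - Pi.single (b e) 1

lemma path_flow {V E : Type*} [DecidableEq V] [DecidableEq E] (a b : E → V) (A : Finset E)
    {x z : V} (p : (edgeGraph a b A).Walk x z) (hp : p.IsPath) :
    ∃ U U' : Finset E, U ⊆ A ∧ U' ⊆ A ∧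
      (∀ e ∈ U, a e ∈ p.support ∧ b e ∈ p.support) ∧
      (∀ e ∈ U', a e ∈ p.support ∧ b e ∈ p.support) ∧
      ∑ e ∈ U, edgeVec a b e - ∑ e ∈ U', edgeVec a b e =
        (Pi.single x 1 - Pi.single z 1 : V → ℤ) := by
  induction p with
  | nil => exact ⟨∅, ∅, by simp⟩
  | @cons u v w h p ih =>
    rw [SimpleGraph.Walk.cons_isPath_iff] at hp
    obtain ⟨U, U', hU, hU', hs, hs', hsum⟩ := ih hp.1
    have h' := (SimpleGraph.fromRel_adj _ _ _).mp h
    have hv : v ∈ p.support := p.start_mem_support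
    obtain ⟨hne, ⟨e, he, hae, hbe⟩ | ⟨e, he, hae, hbe⟩⟩ := h'
    · have heU : e ∉ U := fun hh => hp.2 (hae ▸ (hs e hh).1)
      refine ⟨insert e U, U', Finset.insert_subset he hU, hU', ?_, ?_, ?_⟩
      · intro f hf
        rcases Finset.mem_insert.mp hf with rfl | hf
        · simp [hae, hbe, hv]
        · simp [hs f hf]
      · intro f hf
        simp [hs' f hf]
      · rw [Finset.sum_insert heU, add_sub_assoc, hsum, edgeVec, hae, hbe]
        abel
    · have heU : e ∉ U' := fun hh => hp.2 (hbe ▸ (hs' e hh).2)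
      refine ⟨U, insert e U', hU, Finset.insert_subset he hU', ?_, ?_, ?_⟩
      · intro f hf
        simp [hs f hf]
      · intro f hf
        rcases Finset.mem_insert.mp hf with rfl | hf
        · simp [hae, hbe, hv]
        · simp [hs' f hf]
      · have : ∑ e ∈ U, edgeVec a b e - ∑ e ∈ insert e U', edgeVec a b e =
          (∑ e ∈ U, edgeVec a b e - ∑ e ∈ U', edgeVec a b e) - edgeVec a b e := by
          rw [Finset.sum_insert heU]; abel
        rw [this, hsum, edgeVec, hae, hbe]
        abel

lemma exists_potential {K : Type*} [Field K] {V E : Type*} [DecidableEq V] [DecidableEq E]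
    (a b : E → V) (y : E → K) (A : Finset E) :
    (∀ U ⊆ A, ∀ U' ⊆ A, ∑ e ∈ U, edgeVec a b e = ∑ e ∈ U', edgeVec a b e →
      ∑ e ∈ U, y e = ∑ e ∈ U', y e) →
    ∃ φ : V → K, ∀ e ∈ A, y e = φ (a e) - φ (b e) := by
  classical
  induction A using Finset.induction_on with
  | empty => exact fun _ => ⟨0, by simp⟩
  | insert e₀ A he₀ ih =>
    intro hy
    obtain ⟨φ, hφ⟩ := ih fun U hU U' hU' =>
      hy U (hU.trans (Finset.subset_insert _ _)) U' (hU'.trans (Finset.subset_insert _ _))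
    by_cases hr : (edgeGraph a b A).Reachable (a e₀) (b e₀)
    · obtain ⟨p, hp⟩ := hr.exists_isPath
      obtain ⟨U, U', hU, hU', -, -, hsum⟩ := path_flow a b A p hp
      have heU' : e₀ ∉ U' := fun h => he₀ (hU' h)
      have h1 := hy U (hU.trans (Finset.subset_insert _ _)) (insert e₀ U')
        (Finset.insert_subset_insert _ hU') (by
          rw [Finset.sum_insert heU', edgeVec, ← hsum]; abel)
      rw [Finset.sum_insert heU'] at h1
      -- sums of `y` along the path via `φ`
      have hlin : ∀ W ⊆ A, ∑ e ∈ W, y e =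
          Finsupp.linearCombination K φ
            (∑ e ∈ W, (Finsupp.single (a e) 1 - Finsupp.single (b e) 1 : V →₀ K)) := by
        intro W hW
        rw [map_sum]
        refine Finset.sum_congr rfl fun e he => ?_
        rw [hφ e (hW he)]
        simp
      have hfs : (∑ e ∈ U, (Finsupp.single (a e) 1 - Finsupp.single (b e) 1 : V →₀ K)) -
          (∑ e ∈ U', (Finsupp.single (a e) 1 - Finsupp.single (b e) 1 : V →₀ K)) =
          Finsupp.single (a e₀) 1 - Finsupp.single (b e₀) 1 := by
        ext v
        have := congrFun hsum v
        have := congrArg (Int.cast : ℤ → K) this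
        simpa [edgeVec, Finset.sum_apply, Finsupp.finsetSum_apply, Pi.single_apply,
          Finsupp.single_apply, eq_comm] using this
      refine ⟨φ, fun e he => ?_⟩
      rcases Finset.mem_insert.mp he with rfl | he
      · have h2 := congrArg (Finsupp.linearCombination K φ) hfs
        rw [map_sub, ← hlin U hU, ← hlin U' hU', h1] at h2
        simpa using h2
      · exact hφ e he
    · refine ⟨fun v => φ v + if (edgeGraph a b A).Reachable (a e₀) v then
        y e₀ - (φ (a e₀) - φ (b e₀)) else 0, fun e he => ?_⟩
      rcases Finset.mem_insert.mp he with rfl | he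
      · simp [hr]
        ring
      · have hab : (edgeGraph a b A).Reachable (a e) (b e) := by
          by_cases h : a e = b e
          · rw [h]
          · exact SimpleGraph.Adj.reachable
              ((SimpleGraph.fromRel_adj _ _ _).mpr ⟨h, Or.inl ⟨e, he, rfl, rfl⟩⟩)
        have : (edgeGraph a b A).Reachable (a e₀) (a e) ↔
            (edgeGraph a b A).Reachable (a e₀) (b e) :=
          ⟨fun h => h.trans hab, fun h => h.trans hab.symm⟩
        simp only [this, hφ e he]
        ring

section Phi

variable {K : Type*} [Field K] {n : ℕ} {E : Type*} [Fintype E] [DecidableEq E]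

/-- image of the variable -/
def uu (E : Type*) (q : K) (e : E) : PhiAlg K E (fun _ => q) :=
  Ideal.Quotient.mk _ (X e)

/-- squarefree monomial -/
def uS (q : K) (S : Finset E) : PhiAlg K E (fun _ => q) := ∏ e ∈ S, uu E q e

/-- degree filtration of `Φ` -/
def Dk (E : Type*) (q : K) (k : ℕ) : Submodule K (PhiAlg K E (fun _ => q)) :=
  Submodule.map (Ideal.Quotient.mkₐ K (relIdeal K E (fun _ => q))).toLinearMap
          (MvPolynomial.restrictTotalDegree E K k)

omit [Fintype E] [DecidableEq E] in
lemma smul_eq_mk (q r : K) (x : PhiAlg K E (fun _ => q)) :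
    r • x = Ideal.Quotient.mk (relIdeal K E (fun _ => q)) (C r) * x := by
  obtain ⟨F, rfl⟩ := Ideal.Quotient.mk_surjective x
  rw [← map_mul, ← smul_eq_C_mul]
  rfl

omit [Fintype E] [DecidableEq E] in
lemma uu_mul_self (q : K) (e : E) : uu E q e * uu E q e = q • uu E q e := by
  have h : (X e ^ 2 - C q * X e : MvPolynomial E K) ∈ relIdeal K E (fun _ => q) :=
    Ideal.subset_span ⟨e, rfl⟩
  have h2 := Ideal.Quotient.eq_zero_iff_mem.mpr h
  rw [map_sub, sub_eq_zero, map_pow, map_mul] at h2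
  rw [← pow_two, smul_eq_mk]
  exact h2

omit [Fintype E] [DecidableEq E] in
lemma uu_pow (q : K) (e : E) (m : ℕ) : uu E q e ^ (m + 1) = q ^ m • uu E q e := by
  induction m with
  | zero => simp
  | succ m ih =>
    rw [pow_succ, ih, smul_mul_assoc, uu_mul_self, smul_smul, pow_succ]

omit [Fintype E] [DecidableEq E] in
lemma mem_Dk {q : K} {k : ℕ} {f : PhiAlg K E (fun _ => q)} :
    f ∈ Dk E q k ↔ ∃ F : MvPolynomial E K, F.totalDegree ≤ k ∧
      Ideal.Quotient.mk (relIdeal K E (fun _ => q)) F = f := by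
  simp only [Dk, Submodule.mem_map, mem_restrictTotalDegree]
  rfl

omit [Fintype E] [DecidableEq E] in
lemma Dk_mono (q : K) {j k : ℕ} (h : j ≤ k) : Dk E q j ≤ Dk E q k := by
  intro f hf
  rw [mem_Dk] at *
  obtain ⟨F, h1, h2⟩ := hf
  exact ⟨F, h1.trans h, h2⟩

omit [Fintype E] [DecidableEq E] in
lemma Dk_mul {q : K} {j k : ℕ} {f g : PhiAlg K E (fun _ => q)} (hf : f ∈ Dk E q j)
    (hg : g ∈ Dk E q k) : f * g ∈ Dk E q (j + k) := by
  rw [mem_Dk] at *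
  obtain ⟨F, h1, rfl⟩ := hf
  obtain ⟨G, h3, rfl⟩ := hg
  exact ⟨F * G, (totalDegree_mul _ _).trans (add_le_add h1 h3), map_mul _ _ _⟩

omit [Fintype E] [DecidableEq E] in
lemma one_mem_Dk (q : K) (k : ℕ) : (1 : PhiAlg K E (fun _ => q)) ∈ Dk E q k :=
  mem_Dk.mpr ⟨1, by simp, map_one _⟩

omit [Fintype E] [DecidableEq E] in
lemma uu_mem_Dk (q : K) (e : E) : uu E q e ∈ Dk E q 1 :=
  mem_Dk.mpr ⟨X e, by simp, rfl⟩

omit [Fintype E] in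
lemma uS_mem_Dk (q : K) (S : Finset E) : uS q S ∈ Dk E q S.card := by
  induction S using Finset.induction_on with
  | empty => exact one_mem_Dk q 0
  | insert e S he ih =>
    rw [uS, Finset.prod_insert he, Finset.card_insert_of_notMem he, add_comm]
    exact Dk_mul (uu_mem_Dk q e) ih

lemma Dk_expand (q : K) (k : ℕ) {f : PhiAlg K E (fun _ => q)} (hf : f ∈ Dk E q k) :
    ∃ c : Finset E → K, (∀ S, k < S.card → c S = 0) ∧ f = ∑ S, c S • uS q S := by
  have h1 : f ∈ Submodule.span K {g | ∃ S : Finset E, S.card ≤ k ∧ g = uS q S} := by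
    obtain ⟨F, hF, rfl⟩ := mem_Dk.mp hf
    rw [F.as_sum, map_sum]
    refine Submodule.sum_mem _ fun d hd => ?_
    have h2 : Ideal.Quotient.mk (relIdeal K E (fun _ => q)) (monomial d (coeff d F)) =
        (coeff d F * ∏ e ∈ d.support, q ^ (d e - 1)) • uS q d.support := by
      rw [monomial_eq, map_mul, mul_smul, smul_eq_mk]
      congr 1
      rw [Finsupp.prod, map_prod, uS, ← Finset.prod_smul]
      refine Finset.prod_congr rfl fun e he => ?_
      rw [← uu_pow, map_pow, Nat.sub_add_cancel]
      · rfl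
      · exact Nat.one_le_iff_ne_zero.mpr (Finsupp.mem_support_iff.mp he)
    rw [h2]
    refine Submodule.smul_mem _ _ (Submodule.subset_span ⟨_, ?_, rfl⟩)
    refine le_trans ?_ ((le_totalDegree hd).trans hF)
    rw [Finset.card_eq_sum_ones, Finsupp.sum]
    exact Finset.sum_le_sum fun e he => Nat.one_le_iff_ne_zero.mpr (Finsupp.mem_support_iff.mp he)
  induction h1 using Submodule.span_induction with
  | mem x hx =>
    obtain ⟨S, hS, rfl⟩ := hx
    refine ⟨Pi.single S 1, fun T hT => ?_, ?_⟩
    · rw [Pi.single_eq_of_ne]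
      rintro rfl
      omega
    · rw [Finset.sum_eq_single S]
      · simp
      · intro T _ hT
        simp [Pi.single_eq_of_ne hT]
      · simp
  | zero => exact ⟨0, by simp, by simp⟩
  | add x y hx hy ihx ihy =>
    have aux : ∀ z ∈ Submodule.span K {g | ∃ S : Finset E, S.card ≤ k ∧ g = uS q S},
        z ∈ Dk E q k := by
      intro z hz
      refine Submodule.span_le.mpr ?_ hz
      rintro _ ⟨S, hS, rfl⟩
      exact Dk_mono q hS (uS_mem_Dk q S)
    obtain ⟨c, hc, rfl⟩ := ihx (aux _ hx)
    obtain ⟨d, hd, rfl⟩ := ihy (aux _ hy)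
    refine ⟨c + d, fun S hS => by simp [hc S hS, hd S hS], ?_⟩
    simp [add_smul, Finset.sum_add_distrib]
  | smul r x hx ihx =>
    have aux : ∀ z ∈ Submodule.span K {g | ∃ S : Finset E, S.card ≤ k ∧ g = uS q S},
        z ∈ Dk E q k := by
      intro z hz
      refine Submodule.span_le.mpr ?_ hz
      rintro _ ⟨S, hS, rfl⟩
      exact Dk_mono q hS (uS_mem_Dk q S)
    obtain ⟨c, hc, rfl⟩ := ihx (aux _ hx)
    refine ⟨r • c, fun S hS => by simp [hc S hS], ?_⟩
    simp [Finset.smul_sum, mul_smul]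

/-- elementary symmetric element -/
def sig (q : K) (z : E → K) (k : ℕ) : PhiAlg K E (fun _ => q) :=
  ∑ S ∈ Finset.univ.powersetCard k, (∏ e ∈ S, z e) • uS q S

lemma sig_step (q : K) (z : E → K) (k : ℕ) :
    (∑ e, z e • uu E q e) * sig q z k - ((k + 1 : ℕ) : K) • sig q z (k + 1) ∈ Dk E q k := by
  have h1 : (∑ e, z e • uu E q e) * sig q z k =
      ∑ S ∈ Finset.univ.powersetCard k,
        (∑ e ∈ S, (z e * ∏ e ∈ S, z e) • (uu E q e * uS q S) +
          ∑ e ∈ Sᶜ, (∏ e ∈ insert e S, z e) • uS q (insert e S)) := by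
    rw [sig, Finset.mul_sum]
    refine Finset.sum_congr rfl fun S _ => ?_
    rw [Finset.sum_mul, ← Finset.sum_add_sum_compl S]
    congr 1
    · exact Finset.sum_congr rfl fun e _ => smul_mul_smul_comm _ _ _ _
    · refine Finset.sum_congr rfl fun e he => ?_
      rw [Finset.mem_compl] at he
      rw [smul_mul_smul_comm, uS, uS, Finset.prod_insert he, Finset.prod_insert he]
  have h2 : ∑ S ∈ Finset.univ.powersetCard k,
      ∑ e ∈ Sᶜ, (∏ e ∈ insert e S, z e) • uS q (insert e S) =
      ((k + 1 : ℕ) : K) • sig q z (k + 1) := by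
    have h3 : ((k + 1 : ℕ) : K) • sig q z (k + 1) =
        ∑ T ∈ Finset.univ.powersetCard (k + 1), ∑ _e ∈ T, (∏ e ∈ T, z e) • uS q T := by
      rw [sig, Finset.smul_sum]
      refine Finset.sum_congr rfl fun T hT => ?_
      rw [Finset.sum_const, (Finset.mem_powersetCard.mp hT).2, Nat.cast_smul_eq_nsmul]
    rw [h3, Finset.sum_sigma', Finset.sum_sigma']
    refine Finset.sum_bij' (fun x _ => ⟨insert x.2 x.1, x.2⟩) (fun x _ => ⟨x.1.erase x.2, x.2⟩)
      ?_ ?_ ?_ ?_ ?_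
    · rintro ⟨S, e⟩ h
      simp only [Finset.mem_sigma, Finset.mem_powersetCard, Finset.mem_compl] at h ⊢
      simp [Finset.card_insert_of_notMem h.2, h.1.2]
    · rintro ⟨S, e⟩ h
      simp only [Finset.mem_sigma, Finset.mem_powersetCard, Finset.mem_compl] at h ⊢
      simp [Finset.card_erase_of_mem h.2, h.1.2]
    · rintro ⟨S, e⟩ h
      simp only [Finset.mem_sigma, Finset.mem_powersetCard, Finset.mem_compl] at h ⊢
      simp [Finset.erase_insert h.2]
    · rintro ⟨S, e⟩ h
      simp only [Finset.mem_sigma, Finset.mem_powersetCard, Finset.mem_compl] at h ⊢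
      simp [Finset.insert_erase h.2]
    · rintro ⟨S, e⟩ h
      rfl
  rw [h1, Finset.sum_add_distrib, h2, add_sub_cancel_right]
  refine Submodule.sum_mem _ fun S hS => Submodule.sum_mem _ fun e he => Submodule.smul_mem _ _ ?_
  have h4 : uu E q e * uS q S = q • uS q S := by
    rw [uS, ← Finset.mul_prod_erase _ _ he, ← mul_assoc, uu_mul_self, smul_mul_assoc]
  rw [h4]
  refine Submodule.smul_mem _ _ ?_
  rw [← (Finset.mem_powersetCard.mp hS).2]
  exact uS_mem_Dk q S

lemma pow_sub_sig (q : K) (z : E → K) (k : ℕ) :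
    (∑ e, z e • uu E q e) ^ (k + 1) - ((k + 1).factorial : K) • sig q z (k + 1) ∈ Dk E q k := by
  induction k with
  | zero =>
    have := sig_step q z 0
    simpa [sig, uS] using this
  | succ k ih =>
    have hL : (∑ e, z e • uu E q e) ∈ Dk E q 1 :=
      Submodule.sum_mem _ fun e _ => Submodule.smul_mem _ _ (uu_mem_Dk q e)
    have h1 := Dk_mul hL ih
    have h2 := Submodule.smul_mem _ ((k + 1).factorial : K) (sig_step q z (k + 1))
    rw [add_comm 1 k] at h1
    have h3 := Submodule.add_mem _ h1 h2
    convert h3 using 1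
    rw [Nat.factorial_succ (k + 1), smul_sub, smul_smul, mul_sub, mul_smul_comm, ← pow_succ']
    rw [mul_comm (k + 1 + 1) (k + 1).factorial, Nat.cast_mul]
    abel

/-- evaluation at the vertex of the cube -/
def ev (q : K) (S : Finset E) : PhiAlg K E (fun _ => q) →ₐ[K] K :=
  Ideal.Quotient.liftₐ (relIdeal K E (fun _ => q)) (aeval fun e => if e ∈ S then q else 0) (by
    intro x hx
    have : relIdeal K E (fun _ => q) ≤
        RingHom.ker (aeval (fun e => if e ∈ S then q else 0) : MvPolynomial E K →ₐ[K] K) := by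
      rw [relIdeal, Ideal.span_le]
      rintro _ ⟨e, rfl⟩
      simp only [SetLike.mem_coe, RingHom.mem_ker, map_sub, map_pow, map_mul, aeval_X]
      split_ifs <;> simp [pow_two]
    exact this hx)

omit [Fintype E] in
lemma ev_uu (q : K) (S : Finset E) (e : E) : ev q S (uu E q e) = if e ∈ S then q else 0 := by
  have : ev q S (uu E q e) = (aeval fun e => if e ∈ S then q else 0 : MvPolynomial E K →ₐ[K] K) (X e) := rfl
  rw [this, aeval_X]

omit [Fintype E] in
lemma ev_uS (q : K) (S R : Finset E) :
    ev q S (uS q R) = if R ⊆ S then q ^ R.card else 0 := by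
  rw [uS, map_prod]
  simp only [ev_uu]
  split_ifs with h
  · rw [Finset.prod_congr rfl (fun e he => if_pos (h he)), Finset.prod_const]
  · obtain ⟨e, he, heS⟩ := Finset.not_subset.mp h
    exact Finset.prod_eq_zero he (if_neg heS)

omit [DecidableEq E] in
lemma XX_eq (a b : E → Fin n) (q : K) (i : Fin n) :
    XX K a b (fun _ => q) i = ∑ e, ((edgeVec a b e i : ℤ) : K) • uu E q e := by
  rw [XX, map_sub, map_sum, map_sum, Finset.sum_filter, Finset.sum_filter,
    ← Finset.sum_sub_distrib]
  refine Finset.sum_congr rfl fun e _ => ?_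
  by_cases h1 : a e = i <;> by_cases h2 : b e = i <;>
    simp [edgeVec, Pi.single_apply, h1, h2, uu, eq_comm]

lemma ev_eq_of_mem (a b : E → Fin n) (q : K) (S T : Finset E)
    (h : ∑ e ∈ S, edgeVec a b e = ∑ e ∈ T, edgeVec a b e)
    {f : PhiAlg K E (fun _ => q)} (hf : f ∈ PsiAlg K a b (fun _ => q)) : ev q S f = ev q T f := by
  have hX : ∀ (S : Finset E) i, ev q S (XX K a b (fun _ => q) i) =
      (((∑ e ∈ S, edgeVec a b e) i : ℤ) : K) * q := by
    intro S i
    rw [XX_eq, map_sum]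
    simp [ev_uu, Finset.sum_apply, Finset.sum_mul]
  have : PsiAlg K a b (fun _ => q) ≤ AlgHom.equalizer (ev q S) (ev q T) := by
    rw [PsiAlg, Algebra.adjoin_le_iff]
    rintro _ ⟨i, rfl⟩
    change ev q S _ = ev q T _
    rw [hX, hX, h]
  exact this hf

omit [Fintype E] in
lemma alt_sum (S U R : Finset E) (hU : Disjoint S U) :
    ∑ T ∈ S.powerset, (-1 : K) ^ (S \ T).card * (if R ⊆ T ∪ U then 1 else 0) =
      if S ⊆ R ∧ R ⊆ S ∪ U then 1 else 0 := by
  have h1 : ∏ i ∈ S, ((1 : K) + if i ∈ R then 0 else -1) = if S ⊆ R then 1 else 0 := by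
    split_ifs with h
    · exact Finset.prod_eq_one fun i hi => by simp [h hi]
    · obtain ⟨e, he, heS⟩ := Finset.not_subset.mp h
      exact Finset.prod_eq_zero he (by simp [heS])
  rw [Finset.prod_add] at h1
  by_cases hR : R ⊆ S ∪ U
  · simp only [hR, and_true, ← h1]
    refine Finset.sum_congr rfl fun T hT => ?_
    rw [Finset.mem_powerset] at hT
    rw [Finset.prod_const_one, one_mul]
    split_ifs with h
    · rw [mul_one, ← Finset.prod_const]
      refine Finset.prod_congr rfl fun i hi => ?_
      rw [Finset.mem_sdiff] at hi
      have : i ∉ R := fun hiR => by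
        rcases Finset.mem_union.mp (h hiR) with h' | h'
        · exact hi.2 h'
        · exact Finset.disjoint_left.mp hU hi.1 h'
      simp [this]
    · obtain ⟨e, he, heS⟩ := Finset.not_subset.mp h
      rw [Finset.mem_union, not_or] at heS
      have heS' : e ∈ S := (Finset.mem_union.mp (hR he)).resolve_right heS.2
      rw [mul_zero, Finset.prod_eq_zero (Finset.mem_sdiff.mpr ⟨heS', heS.1⟩)]
      simp [he]
  · simp only [hR, and_false, if_false]
    refine Finset.sum_eq_zero fun T hT => ?_
    rw [Finset.mem_powerset] at hT
    rw [if_neg, mul_zero]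
    exact fun h => hR (h.trans (Finset.union_subset_union_left hT))

lemma diff_formula (q : K) (k : ℕ) (c : Finset E → K) (hc : ∀ S, k + 1 < S.card → c S = 0)
    (S U : Finset E) (hS : S.card = k) (hU : Disjoint S U) :
    ∑ T ∈ S.powerset, (-1 : K) ^ (S \ T).card * ev q (T ∪ U) (∑ R, c R • uS q R) =
      q ^ k * c S + q ^ (k + 1) * ∑ e ∈ U, c (insert e S) := by
  have h1 : ∑ T ∈ S.powerset, (-1 : K) ^ (S \ T).card * ev q (T ∪ U) (∑ R, c R • uS q R) =
      ∑ R, (c R * q ^ R.card) * (if S ⊆ R ∧ R ⊆ S ∪ U then 1 else 0) := by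
    simp only [← alt_sum (K := K) S U _ hU, map_sum, map_smul, ev_uS, Finset.mul_sum]
    rw [Finset.sum_comm]
    refine Finset.sum_congr rfl fun R _ => Finset.sum_congr rfl fun T _ => ?_
    split_ifs
    · simp only [smul_eq_mul]; ring
    · simp
  rw [h1]
  have hnot : ∀ e ∈ U, e ∉ S := fun e he h => Finset.disjoint_left.mp hU h he
  have h2 : ∑ R ∈ insert S (U.image fun e => insert e S),
      (c R * q ^ R.card) * (if S ⊆ R ∧ R ⊆ S ∪ U then 1 else 0) =
      ∑ R, (c R * q ^ R.card) * (if S ⊆ R ∧ R ⊆ S ∪ U then 1 else 0) := by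
    refine Finset.sum_subset (Finset.subset_univ _) fun R _ hR => ?_
    split_ifs with h
    · rw [Finset.mem_insert, not_or] at hR
      by_cases hcard : k + 1 < R.card
      · simp [hc R hcard]
      · exfalso
        have hss : S ⊂ R := Finset.ssubset_iff_subset_ne.mpr ⟨h.1, fun h => hR.1 h.symm⟩
        obtain ⟨e, he, hsub⟩ := Finset.ssubset_iff.mp hss
        have heq : insert e S = R := Finset.eq_of_subset_of_card_le hsub (by
          rw [Finset.card_insert_of_notMem he, hS]; omega)
        apply hR.2
        refine Finset.mem_image.mpr ⟨e, ?_, heq⟩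
        have : e ∈ S ∪ U := h.2 (hsub (Finset.mem_insert_self _ _))
        exact (Finset.mem_union.mp this).resolve_left he
    · simp
  rw [← h2, Finset.sum_insert, Finset.sum_image]
  · congr 1
    · simp [hS, mul_comm]
    · rw [Finset.mul_sum]
      refine Finset.sum_congr rfl fun e he => ?_
      rw [if_pos, Finset.card_insert_of_notMem (hnot e he), hS]
      · ring
      · refine ⟨Finset.subset_insert _ _, Finset.insert_subset ?_ Finset.subset_union_left⟩
        exact Finset.mem_union_right _ he
  · intro e he f hf hef
    have : e ∈ insert f S := by
      have h : insert e S = insert f S := hef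
      rw [← h]; exact Finset.mem_insert_self _ _
    exact (Finset.mem_insert.mp this).resolve_right (hnot e he)
  · intro h
    obtain ⟨e, he, heq⟩ := Finset.mem_image.mp h
    exact hnot e he (heq ▸ Finset.mem_insert_self _ _)

lemma Fk_mono (a b : E → Fin n) (q : E → K) {j k : ℕ} (h : j ≤ k) :
    Fk K a b q j ≤ Fk K a b q k :=
  Submodule.span_mono fun _ ⟨α, h1, h2⟩ => ⟨α, h1.trans h, h2⟩

lemma aeval_mem_Fk (a b : E → Fin n) (q : E → K) {k : ℕ} (P : MvPolynomial (Fin n) K)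
    (hP : P.totalDegree ≤ k) : aeval (XX K a b q) P ∈ Fk K a b q k := by
  rw [P.as_sum, map_sum]
  refine Submodule.sum_mem _ fun d hd => ?_
  rw [aeval_monomial, ← Algebra.smul_def]
  refine Submodule.smul_mem _ _ (Submodule.subset_span ⟨d, ?_, ?_⟩)
  · refine le_trans ?_ ((le_totalDegree hd).trans hP)
    rw [Finsupp.sum_fintype _ _ (fun _ => rfl)]
  · rw [Finsupp.prod_fintype _ _ (fun _ => pow_zero _)]

lemma Fk_le_Psi (a b : E → Fin n) (q : E → K) (k : ℕ) :
    Fk K a b q k ≤ Subalgebra.toSubmodule (PsiAlg K a b q) := by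
  rw [Fk, Submodule.span_le]
  rintro _ ⟨α, -, rfl⟩
  exact Subalgebra.prod_mem _ fun i _ => Subalgebra.pow_mem _
    (Algebra.subset_adjoin (Set.mem_range_self i)) _

lemma Fk_le_Dk (a b : E → Fin n) (q : K) (k : ℕ) :
    Fk K a b (fun _ => q) k ≤ Dk E q k := by
  rw [Fk, Submodule.span_le]
  rintro _ ⟨α, hα, rfl⟩
  refine Dk_mono q hα ?_
  have hX : ∀ i, XX K a b (fun _ => q) i ∈ Dk E q 1 := fun i => by
    rw [XX_eq]
    exact Submodule.sum_mem _ fun e _ => Submodule.smul_mem _ _ (uu_mem_Dk q e)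
  have hpow : ∀ i m, XX K a b (fun _ => q) i ^ m ∈ Dk E q m := by
    intro i m
    induction m with
    | zero => rw [pow_zero]; exact one_mem_Dk q 0
    | succ m ih => rw [pow_succ]; exact Dk_mul ih (hX i)
  have : ∀ s : Finset (Fin n), ∏ i ∈ s, XX K a b (fun _ => q) i ^ α i ∈
      Dk E q (∑ i ∈ s, α i) := by
    intro s
    induction s using Finset.induction_on with
    | empty => exact one_mem_Dk q _
    | insert i s hi ih =>
      rw [Finset.prod_insert hi, Finset.sum_insert hi]
      exact Dk_mul (hpow i _) ih
  exact this _

/-- The case `q = 0`. -/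
lemma case_zero (a b : E → Fin n) (k : ℕ) {f : PhiAlg K E (fun _ => (0 : K))}
    (hf : f ∈ PsiAlg K a b (fun _ => (0 : K))) (hD : f ∈ Dk E (0 : K) k) :
    f ∈ Fk K a b (fun _ => (0 : K)) k := by
  rw [PsiAlg, Algebra.adjoin_range_eq_range_aeval] at hf
  obtain ⟨P, hP⟩ := hf
  obtain ⟨F, hF, hFf⟩ := mem_Dk.mp hD
  let ℓ : Fin n → MvPolynomial E K := fun i =>
    (∑ e ∈ Finset.univ.filter fun e => a e = i, X e) -
      ∑ e ∈ Finset.univ.filter fun e => b e = i, X e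
  have hℓ : ∀ i, (ℓ i).IsHomogeneous 1 := fun i =>
    (IsHomogeneous.sum _ _ _ fun e _ => isHomogeneous_X _ e).sub
      (IsHomogeneous.sum _ _ _ fun e _ => isHomogeneous_X _ e)
  have hmk : ∀ P : MvPolynomial (Fin n) K, Ideal.Quotient.mk (relIdeal K E (fun _ => (0 : K)))
      (aeval ℓ P) = aeval (XX K a b (fun _ => (0 : K))) P := by
    intro P
    have : (Ideal.Quotient.mkₐ K (relIdeal K E (fun _ => (0 : K)))).comp (aeval ℓ) =
        aeval (XX K a b (fun _ => (0 : K))) := by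
      apply MvPolynomial.algHom_ext
      intro i
      simp only [AlgHom.comp_apply, aeval_X]
      rfl
    exact AlgHom.congr_fun this P
  have hcomp : ∀ j, homogeneousComponent j (aeval ℓ P) = aeval ℓ (homogeneousComponent j P) := by
    intro j
    have hh : ∀ i, (aeval ℓ (homogeneousComponent i P)).IsHomogeneous i := fun i => by
      have := (homogeneousComponent_isHomogeneous i P).aeval ℓ hℓ
      rwa [one_mul] at this
    conv_lhs => rw [← sum_homogeneousComponent P, map_sum, map_sum]
    rw [Finset.sum_congr rfl fun i _ => homogeneousComponent_of_mem (n := i) (m := j) (hh i)]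
    rw [Finset.sum_ite_eq]
    split_ifs with h
    · rfl
    · rw [homogeneousComponent_eq_zero, map_zero]
      simp at h
      omega
  letI := MvPolynomial.gradedAlgebra (σ := E) (R := K)
  have hI : (relIdeal K E (fun _ => (0 : K))).IsHomogeneous (homogeneousSubmodule E K) := by
    apply Ideal.homogeneous_span
    rintro _ ⟨e, rfl⟩
    refine ⟨2, ?_⟩
    simpa using isHomogeneous_X_pow e 2
  have hmem : aeval ℓ P - F ∈ relIdeal K E (fun _ => (0 : K)) := by
    rw [← Ideal.Quotient.eq, hmk, hFf]
    exact hP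
  have hj : ∀ j, Ideal.Quotient.mk (relIdeal K E (fun _ => (0 : K))) (homogeneousComponent j F) =
      aeval (XX K a b (fun _ => (0 : K))) (homogeneousComponent j P) := by
    intro j
    rw [← hmk, ← hcomp, eq_comm, Ideal.Quotient.eq, ← map_sub]
    exact homogeneousComponent_mem_of_mem hI hmem j
  rw [← hFf, ← sum_homogeneousComponent F, map_sum]
  refine Submodule.sum_mem _ fun j hjj => ?_
  rw [hj]
  refine Fk_mono a b _ ?_ (aeval_mem_Fk a b _ (k := j) _
    (homogeneousComponent_isHomogeneous j P).totalDegree_le)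
  rw [Finset.mem_range] at hjj
  omega

/-- The case `q ≠ 0`. -/
lemma case_ne_zero [CharZero K] (a b : E → Fin n) (q : K) (hq : q ≠ 0) (k : ℕ) :
    ∀ {f : PhiAlg K E (fun _ => q)}, f ∈ PsiAlg K a b (fun _ => q) → f ∈ Dk E q k →
    f ∈ Fk K a b (fun _ => q) k := by
  induction k with
  | zero =>
    intro f hf hD
    obtain ⟨F, hF, rfl⟩ := mem_Dk.mp hD
    have h0 := totalDegree_eq_zero_iff_eq_C.mp (Nat.le_zero.mp hF)
    have := aeval_mem_Fk a b (fun _ => q) (k := 0) (C (coeff 0 F)) (by simp)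
    rw [h0]
    rw [aeval_C] at this
    exact this
  | succ k ih =>
    intro f hf hD
    obtain ⟨c, hc, hfc⟩ := Dk_expand q (k + 1) hD
    let y : Finset E → K := fun S => if S.card = k + 1 then c S else 0
    obtain ⟨l, hl⟩ := exists_functional Finset.univ a b y (fun S _ => by
      by_cases hS : S.card = k
      · obtain ⟨φ, hφ⟩ := exists_potential a b (fun e => c (insert e S)) Sᶜ (by
          intro U hU U' hU' hUU
          have dU : Disjoint S U := Finset.disjoint_left.mpr fun e he he' =>
            Finset.mem_compl.mp (hU he') he
          have dU' : Disjoint S U' := Finset.disjoint_left.mpr fun e he he' =>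
            Finset.mem_compl.mp (hU' he') he
          have h1 := diff_formula q k c hc S U hS dU
          have h2 := diff_formula q k c hc S U' hS dU'
          have h3 : ∑ T ∈ S.powerset, (-1 : K) ^ (S \ T).card * ev q (T ∪ U) (∑ R, c R • uS q R) =
              ∑ T ∈ S.powerset, (-1 : K) ^ (S \ T).card *
                ev q (T ∪ U') (∑ R, c R • uS q R) := by
            refine Finset.sum_congr rfl fun T hT => ?_
            rw [Finset.mem_powerset] at hT
            rw [← hfc, ev_eq_of_mem a b q (T ∪ U) (T ∪ U') _ hf]
            rw [Finset.sum_union (dU.mono_left hT), Finset.sum_union (dU'.mono_left hT), hUU]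
          rw [h1, h2] at h3
          exact mul_left_cancel₀ (pow_ne_zero _ hq) (add_left_cancel h3))
        refine ⟨φ, fun e _ he => ?_⟩
        rw [← hφ e (Finset.mem_compl.mpr he)]
        simp only [y]
        rw [if_pos (by rw [Finset.card_insert_of_notMem he, hS])]
      · refine ⟨0, fun e _ he => ?_⟩
        simp only [y]
        rw [if_neg (by rw [Finset.card_insert_of_notMem he]; omega)]
        simp)
    have hy := mem_span_eval a b y l (fun S => hl S (Finset.subset_univ S))
    -- linear map `z ↦ ∑_{|S| = k+1} z_S u_S`
    let Θ : (Finset E → K) →ₗ[K] PhiAlg K E (fun _ => q) :=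
      ∑ S ∈ Finset.univ.powersetCard (k + 1), (LinearMap.proj S).smulRight (uS q S)
    have hΘ : ∀ z, Θ z = ∑ S ∈ Finset.univ.powersetCard (k + 1), z S • uS q S := by
      intro z
      simp [Θ]
    have hspan : ∀ z ∈ Submodule.span K (Set.range fun (t : Fin n → K) (S : Finset E) =>
        ∏ e ∈ S, (t (a e) - t (b e))), Θ z ∈ Fk K a b (fun _ => q) (k + 1) ⊔ Dk E q k := by
      intro z hz
      refine (Submodule.span_le (p := Submodule.comap Θ
        (Fk K a b (fun _ => q) (k + 1) ⊔ Dk E q k))).mpr ?_ hz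
      rintro _ ⟨t, rfl⟩
      change Θ _ ∈ Fk K a b (fun _ => q) (k + 1) ⊔ Dk E q k
      rw [hΘ]
      have h1 := pow_sub_sig q (fun e => t (a e) - t (b e)) k
      have h2 : ∑ e, (t (a e) - t (b e)) • uu E q e =
          aeval (XX K a b (fun _ => q))
            (∑ i, t i • X i : MvPolynomial (Fin n) K) := by
        simp only [map_sum, map_smul, aeval_X, XX_eq, Finset.smul_sum, smul_smul]
        rw [Finset.sum_comm]
        refine Finset.sum_congr rfl fun e _ => ?_
        rw [← Finset.sum_smul]
        congr 1
        simp [edgeVec, mul_sub, Finset.sum_sub_distrib, Pi.single_apply]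
      have h3 : (∑ e, (t (a e) - t (b e)) • uu E q e) ^ (k + 1) ∈
          Fk K a b (fun _ => q) (k + 1) := by
        rw [h2, ← map_pow]
        apply aeval_mem_Fk
        refine (totalDegree_pow _ _).trans ?_
        have : (∑ i, t i • X i : MvPolynomial (Fin n) K).totalDegree ≤ 1 :=
          totalDegree_finsetSum_le fun i _ => (totalDegree_smul_le _ _).trans (by simp)
        nlinarith
      have hfac : ((k + 1).factorial : K) ≠ 0 := by exact_mod_cast Nat.factorial_ne_zero _
      have h4 : sig q (fun e => t (a e) - t (b e)) (k + 1) =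
          ((k + 1).factorial : K)⁻¹ • ((∑ e, (t (a e) - t (b e)) • uu E q e) ^ (k + 1) -
          ((∑ e, (t (a e) - t (b e)) • uu E q e) ^ (k + 1) -
            ((k + 1).factorial : K) • sig q (fun e => t (a e) - t (b e)) (k + 1))) := by
        rw [sub_sub_cancel, smul_smul, inv_mul_cancel₀ hfac, one_smul]
      change sig q (fun e => t (a e) - t (b e)) (k + 1) ∈
        Fk K a b (fun _ => q) (k + 1) ⊔ Dk E q k
      rw [h4]
      exact Submodule.smul_mem _ _ (Submodule.sub_mem _ (Submodule.mem_sup_left h3)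
        (Submodule.mem_sup_right h1))
    obtain ⟨g, hg, d, hd, hgd⟩ := Submodule.mem_sup.mp (hspan y hy)
    have hrest : f - Θ y ∈ Dk E q k := by
      have : f - Θ y = ∑ S, (c S - y S) • uS q S := by
        rw [hfc, hΘ]
        simp only [sub_smul, Finset.sum_sub_distrib]
        congr 1
        refine Finset.sum_subset (Finset.subset_univ _) fun S _ hS => ?_
        have : S.card ≠ k + 1 := fun h =>
          hS (Finset.mem_powersetCard.mpr ⟨Finset.subset_univ _, h⟩)
        simp [y, this]
      rw [this]
      refine Submodule.sum_mem _ fun S _ => ?_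
      by_cases h1 : S.card = k + 1
      · simp [y, h1]
      · by_cases h2 : k + 1 < S.card
        · simp [y, h1, hc S h2]
        · exact Submodule.smul_mem _ _ (Dk_mono q (by omega) (uS_mem_Dk q S))
    have hfg : f - g ∈ Dk E q k := by
      have : f - g = (f - Θ y) + d := by rw [← hgd]; abel
      rw [this]
      exact Submodule.add_mem _ hrest hd
    have hfg' : f - g ∈ PsiAlg K a b (fun _ => q) :=
      Subalgebra.sub_mem _ hf (Fk_le_Psi a b _ _ hg)
    have := Fk_mono a b _ (Nat.le_succ k) (ih hfg' hfg)
    have h := Submodule.add_mem _ this hg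
    rwa [sub_add_cancel] at h

end Phi

/-- For the Hecke deformation (all `q_e = q`), the filtration induced by the
generators `X_i` coincides with the filtration induced from `Φ_{G,q}` by total degree. -/
theorem hecke_filtration_eq
    {K : Type*} [Field K] [CharZero K] {n : ℕ} {E : Type*} [Fintype E] [DecidableEq E]
    (a b : E → Fin n) (hab : ∀ e, a e < b e) (q : K) (k : ℕ) :
    Fk K a b (fun _ => q) k =
      (PsiAlg K a b (fun _ => q)).toSubmodule ⊓
        Submodule.map (Ideal.Quotient.mkₐ K (relIdeal K E (fun _ => q))).toLinearMap
          (MvPolynomial.restrictTotalDegree E K k) := by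
  apply le_antisymm
  · exact le_inf (Fk_le_Psi a b _ k) (Fk_le_Dk a b q k)
  · rintro f ⟨hf, hD⟩
    by_cases hq : q = 0
    · subst hq
      exact case_zero a b k hf hD
    · exact case_ne_zero a b q hq k hf hD

end
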